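/- Let G be a finite group, f: G → U(d) a unitary representation, and ρ a pure state on ℂ^d; consider the covariant channel g ↦ W_g := f(g)ρf(g)† and set av_f[ρ] := |G|^{−1} Σ_{g∈G} f(g)ρf(g)†. For all ε, δ₁, δ₂ ∈ (0,1) with δ₁ + δ₂ < ε and ε + δ₁ + 2δ₂ < 1, the maximal code size M(ρ,ε) satisfies both log M(ρ,ε) ≥ H_s^{ε−δ₁−δ₂}(av_f[ρ]) − log(1/(δ₁δ₂)) and log M(ρ,ε) ≤ H_s^{ε+δ₁+2δ₂}(av_f[ρ]) + log(1/(δ₁δ₂²)). -/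

import Mathlib

open scoped ComplexOrder

/-- Projection onto the sum of eigenspaces of a Hermitian matrix with nonnegative
eigenvalues (junk value `0` if the matrix is not Hermitian). -/
noncomputable def projNonneg {n : Type*} [Fintype n] [DecidableEq n]
    (A : Matrix n n ℂ) : Matrix n n ℂ :=
  if hA : A.IsHermitian then
    (hA.eigenvectorUnitary : Matrix n n ℂ) *
      Matrix.diagonal (fun i => if 0 ≤ hA.eigenvalues i then (1 : ℂ) else 0) *
      star (hA.eigenvectorUnitary : Matrix n n ℂ)
  else 0

/-- A pure state: a rank-one orthogonal projection, equivalently a Hermitian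
idempotent of trace one. -/
def IsPureState {n : Type*} [Fintype n] (ρ : Matrix n n ℂ) : Prop :=
  ρ.IsHermitian ∧ ρ * ρ = ρ ∧ ρ.trace = 1

/-- A state: a positive semidefinite matrix of trace one. -/
def IsState {n : Type*} [Fintype n] (ρ : Matrix n n ℂ) : Prop :=
  ρ.PosSemidef ∧ ρ.trace = 1

/-- `H_s^ε(ρ) = sup {λ | tr(ρ {ρ ≥ e^{-λ} I}) ≤ ε}`. -/
noncomputable def Hs {n : Type*} [Fintype n] [DecidableEq n]
    (ε : ℝ) (ρ : Matrix n n ℂ) : ℝ :=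
  sSup {lam : ℝ |
    ((ρ * projNonneg (ρ - Real.exp (-lam) • (1 : Matrix n n ℂ))).trace).re ≤ ε}

/-- The group-averaged state `av_f[ρ] = |G|⁻¹ Σ_g f(g) ρ f(g)†`. -/
noncomputable def avf {G : Type*} [Group G] [Fintype G] {n : Type*}
    [Fintype n] [DecidableEq n]
    (f : G →* Matrix.unitaryGroup n ℂ) (ρ : Matrix n n ℂ) : Matrix n n ℂ :=
  ((Fintype.card G : ℂ)⁻¹) •
    ∑ g, (f g : Matrix n n ℂ) * ρ * star (f g : Matrix n n ℂ)

/-- `M` messages can be sent through the covariant channel `g ↦ f(g) ρ f(g)†`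
with error probability at most `ε`: there are codewords `g₁,…,g_M` and a
sub-POVM `Q₁,…,Q_M` with `tr(f(gᵢ) ρ f(gᵢ)† Qᵢ) ≥ 1 − ε` for all `i`. -/
def CodeAchievable {G : Type*} [Group G] [Fintype G] {n : Type*}
    [Fintype n] [DecidableEq n]
    (f : G →* Matrix.unitaryGroup n ℂ) (ρ : Matrix n n ℂ) (ε : ℝ) (M : ℕ) : Prop :=
  ∃ (enc : Fin M → G) (Q : Fin M → Matrix n n ℂ),
    (∀ i, (Q i).PosSemidef) ∧ ((1 : Matrix n n ℂ) - ∑ i, Q i).PosSemidef ∧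
    ∀ i, 1 - ε ≤
      (((f (enc i) : Matrix n n ℂ) * ρ * star (f (enc i) : Matrix n n ℂ)
        * Q i).trace).re

/-- `M(ρ,ε)`: the maximal code size. -/
noncomputable def Mcode {G : Type*} [Group G] [Fintype G] {n : Type*}
    [Fintype n] [DecidableEq n]
    (f : G →* Matrix.unitaryGroup n ℂ) (ρ : Matrix n n ℂ) (ε : ℝ) : ℕ :=
  sSup {M : ℕ | CodeAchievable f ρ ε M}

section TraceInequalities

variable {n : Type*} [Fintype n]

theorem Matrix.PosSemidef.re_trace_nonneg {A : Matrix n n ℂ} (hA : A.PosSemidef) :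
    0 ≤ A.trace.re :=
  (Complex.nonneg_iff.mp hA.trace_nonneg).1

/-- A Hermitian idempotent is positive semidefinite. -/
theorem Matrix.IsHermitian.posSemidef_of_mul_self {P : Matrix n n ℂ} (hP : P.IsHermitian)
    (hPP : P * P = P) : P.PosSemidef := by
  have h := Matrix.posSemidef_conjTranspose_mul_self P
  rwa [hP.eq, hPP] at h

variable [DecidableEq n]

theorem Matrix.IsHermitian.eq_eigenvectorUnitary_mul_diagonal_mul_star {A : Matrix n n ℂ}
    (hA : A.IsHermitian) :
    A = (hA.eigenvectorUnitary : Matrix n n ℂ) *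
      Matrix.diagonal (fun i => (hA.eigenvalues i : ℂ)) *
      star (hA.eigenvectorUnitary : Matrix n n ℂ) := by
  conv_lhs => rw [hA.spectral_theorem]
  rfl

theorem Matrix.PosSemidef.re_trace_mul_nonneg {A B : Matrix n n ℂ} (hA : A.PosSemidef)
    (hB : B.PosSemidef) : 0 ≤ (A * B).trace.re := by
  have h := hA.1.eq_eigenvectorUnitary_mul_diagonal_mul_star
  set U : Matrix n n ℂ := hA.1.eigenvectorUnitary.val
  have hC : (star U * B * U).PosSemidef := hB.conjTranspose_mul_mul_same U
  rw [h, Matrix.mul_assoc, Matrix.mul_assoc, Matrix.trace_mul_comm, Matrix.mul_assoc,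
    Matrix.trace, Complex.re_sum]
  refine Finset.sum_nonneg fun i _ => ?_
  rw [Matrix.diag_apply, Matrix.diagonal_mul, Complex.re_ofReal_mul]
  exact mul_nonneg (hA.eigenvalues_nonneg i) (Complex.nonneg_iff.mp hC.diag_nonneg).1

theorem Matrix.PosSemidef.re_trace_mul_le {A B C : Matrix n n ℂ} (hAB : (B - A).PosSemidef)
    (hC : C.PosSemidef) : (A * C).trace.re ≤ (B * C).trace.re := by
  have h := hAB.re_trace_mul_nonneg hC
  rw [Matrix.sub_mul, Matrix.trace_sub, Complex.sub_re] at h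
  linarith

theorem Matrix.PosSemidef.trace_smul_one_sub {A : Matrix n n ℂ} (hA : A.PosSemidef) :
    (A.trace.re • (1 : Matrix n n ℂ) - A).PosSemidef := by
  have h := hA.1.eq_eigenvectorUnitary_mul_diagonal_mul_star
  have hU : (hA.1.eigenvectorUnitary : Matrix n n ℂ) *
      star (hA.1.eigenvectorUnitary : Matrix n n ℂ) = 1 := Unitary.coe_mul_star_self _
  have ht : A.trace.re = ∑ i, hA.1.eigenvalues i := by
    rw [hA.1.trace_eq_sum_eigenvalues, Complex.re_sum]; rfl
  have hD : (Matrix.diagonal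
      (fun i => ((A.trace.re - hA.1.eigenvalues i : ℝ) : ℂ))).PosSemidef := by
    refine Matrix.PosSemidef.diagonal fun i => ?_
    refine Complex.zero_le_real.mpr (sub_nonneg.mpr ?_)
    rw [ht]
    exact Finset.single_le_sum (fun j _ => hA.eigenvalues_nonneg j) (Finset.mem_univ i)
  have key := hD.mul_mul_conjTranspose_same (hA.1.eigenvectorUnitary : Matrix n n ℂ)
  convert key using 1
  have hdiag : Matrix.diagonal (fun i => ((A.trace.re - hA.1.eigenvalues i : ℝ) : ℂ)) =
      A.trace.re • (1 : Matrix n n ℂ) -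
        Matrix.diagonal (fun i => (hA.1.eigenvalues i : ℂ)) := by
    ext i j
    by_cases hij : i = j
    · subst hij; simp
    · simp [hij]
  rw [hdiag, Matrix.mul_sub, Matrix.sub_mul, Matrix.mul_smul, Matrix.mul_one, Matrix.smul_mul,
    ← Matrix.star_eq_conjTranspose, hU, ← h]

theorem Matrix.PosSemidef.sub_mul_self {S : Matrix n n ℂ} (hS : S.PosSemidef)
    (hS' : (1 - S).PosSemidef) : (S - S * S).PosSemidef := by
  have h1 := hS'.mul_mul_conjTranspose_same S
  have h2 := hS.mul_mul_conjTranspose_same (1 - S)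
  rw [hS.1.eq] at h1
  rw [hS'.1.eq] at h2
  have h := h1.add h2
  convert h using 1
  noncomm_ring

end TraceInequalities

section ProjNonneg

variable {n : Type*} [Fintype n] [DecidableEq n] {A : Matrix n n ℂ}

theorem projNonneg_isHermitian (A : Matrix n n ℂ) : (projNonneg A).IsHermitian := by
  unfold projNonneg
  split_ifs with hA
  · refine Matrix.isHermitian_mul_mul_conjTranspose _
      (Matrix.isHermitian_diagonal_of_self_adjoint _ ?_)
    ext i
    by_cases h : 0 ≤ hA.eigenvalues i <;> simp [h]
  · exact Matrix.isHermitian_zero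

theorem projNonneg_mul_self (A : Matrix n n ℂ) :
    projNonneg A * projNonneg A = projNonneg A := by
  unfold projNonneg
  split_ifs with hA
  · have hU : star (hA.eigenvectorUnitary : Matrix n n ℂ) *
      (hA.eigenvectorUnitary : Matrix n n ℂ) = 1 := Unitary.coe_star_mul_self _
    set U : Matrix n n ℂ := hA.eigenvectorUnitary.val
    set D : Matrix n n ℂ := Matrix.diagonal fun i => if 0 ≤ hA.eigenvalues i then (1 : ℂ) else 0
      with hD
    have hDD : D * D = D := by
      rw [hD, Matrix.diagonal_mul_diagonal]
      simp
    calc U * D * star U * (U * D * star U) = U * D * (star U * U) * D * star U := by noncomm_ring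
      _ = U * (D * D) * star U := by rw [hU]; noncomm_ring
      _ = U * D * star U := by rw [hDD]
  · simp

/-- `projNonneg A` commutes with everything that commutes with `A`. -/
theorem Commute.projNonneg_right {B : Matrix n n ℂ} (h : Commute B A) :
    Commute B (projNonneg A) := by
  unfold projNonneg
  split_ifs with hA
  · have hU : star (hA.eigenvectorUnitary : Matrix n n ℂ) *
      (hA.eigenvectorUnitary : Matrix n n ℂ) = 1 := Unitary.coe_star_mul_self _
    have hU' : (hA.eigenvectorUnitary : Matrix n n ℂ) *
      star (hA.eigenvectorUnitary : Matrix n n ℂ) = 1 := Unitary.coe_mul_star_self _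
    have hAD := hA.eq_eigenvectorUnitary_mul_diagonal_mul_star
    set U : Matrix n n ℂ := hA.eigenvectorUnitary.val
    set D : Matrix n n ℂ := Matrix.diagonal fun i => if 0 ≤ hA.eigenvalues i then (1 : ℂ) else 0
      with hD
    set L : Matrix n n ℂ := Matrix.diagonal fun i => (hA.eigenvalues i : ℂ) with hL
    set C := star U * B * U with hC
    have hBC : B = U * C * star U := by
      calc B = (U * star U) * B * (U * star U) := by rw [hU']; simp
        _ = U * C * star U := by rw [hC]; noncomm_ring
    have hLA : L = star U * A * U := by
      calc L = (star U * U) * L * (star U * U) := by rw [hU]; simp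
        _ = star U * (U * L * star U) * U := by noncomm_ring
        _ = star U * A * U := by rw [← hAD]
    have hCL : C * L = L * C := by
      calc C * L = star U * B * (U * star U) * A * U := by rw [hLA, hC]; noncomm_ring
        _ = star U * (B * A) * U := by rw [hU']; noncomm_ring
        _ = star U * (A * B) * U := by rw [h.eq]
        _ = star U * A * (U * star U) * B * U := by rw [hU']; noncomm_ring
        _ = L * C := by rw [hLA, hC]; noncomm_ring
    have hCD : C * D = D * C := by
      ext i j
      have hij := congrFun (congrFun hCL i) j
      rw [hL, Matrix.mul_diagonal, Matrix.diagonal_mul] at hij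
      rw [hD, Matrix.mul_diagonal, Matrix.diagonal_mul]
      by_cases hc : C i j = 0
      · simp [hc]
      · rw [mul_comm] at hij
        have := Complex.ofReal_injective (mul_right_cancel₀ hc hij)
        rw [this, mul_comm]
    change B * (U * D * star U) = U * D * star U * B
    calc B * (U * D * star U) = U * C * (star U * U) * D * star U := by rw [hBC]; noncomm_ring
      _ = U * (C * D) * star U := by rw [hU]; noncomm_ring
      _ = U * D * (star U * U) * C * star U := by rw [hCD, hU]; noncomm_ring
      _ = U * D * star U * B := by rw [hBC]; noncomm_ring
  · exact Commute.zero_right B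

theorem posSemidef_projNonneg_mul (hA : A.IsHermitian) : (projNonneg A * A).PosSemidef := by
  have hU : star (hA.eigenvectorUnitary : Matrix n n ℂ) *
      (hA.eigenvectorUnitary : Matrix n n ℂ) = 1 := Unitary.coe_star_mul_self _
  have hAD := hA.eq_eigenvectorUnitary_mul_diagonal_mul_star
  unfold projNonneg
  rw [dif_pos hA]
  set U : Matrix n n ℂ := hA.eigenvectorUnitary.val
  set D : Matrix n n ℂ := Matrix.diagonal fun i => if 0 ≤ hA.eigenvalues i then (1 : ℂ) else 0
    with hD
  set L : Matrix n n ℂ := Matrix.diagonal fun i => (hA.eigenvalues i : ℂ) with hL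
  have hDL : (D * L).PosSemidef := by
    rw [hD, hL, Matrix.diagonal_mul_diagonal]
    refine Matrix.PosSemidef.diagonal fun i => ?_
    by_cases h : 0 ≤ hA.eigenvalues i <;> simp [h]
  have h : U * D * star U * A = U * (D * L) * Matrix.conjTranspose U := by
    calc U * D * star U * A = U * D * (star U * U) * L * star U := by
          nth_rw 1 [hAD]; noncomm_ring
      _ = U * (D * L) * star U := by rw [hU]; noncomm_ring
  rw [h]
  exact hDL.mul_mul_conjTranspose_same U

theorem posSemidef_projNonneg_mul_sub (hA : A.IsHermitian) :
    (projNonneg A * A - A).PosSemidef := by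
  have hU : star (hA.eigenvectorUnitary : Matrix n n ℂ) *
      (hA.eigenvectorUnitary : Matrix n n ℂ) = 1 := Unitary.coe_star_mul_self _
  have hAD := hA.eq_eigenvectorUnitary_mul_diagonal_mul_star
  unfold projNonneg
  rw [dif_pos hA]
  set U : Matrix n n ℂ := hA.eigenvectorUnitary.val
  set D : Matrix n n ℂ := Matrix.diagonal fun i => if 0 ≤ hA.eigenvalues i then (1 : ℂ) else 0
    with hD
  set L : Matrix n n ℂ := Matrix.diagonal fun i => (hA.eigenvalues i : ℂ) with hL
  have hDL : (D * L - L).PosSemidef := by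
    rw [hD, hL, Matrix.diagonal_mul_diagonal, Matrix.diagonal_sub]
    refine Matrix.PosSemidef.diagonal fun i => ?_
    by_cases h : 0 ≤ hA.eigenvalues i
    · simp [h]
    · simp only [h, if_false, zero_mul, zero_sub, Pi.zero_apply]
      exact neg_nonneg.mpr (by exact_mod_cast (not_le.mp h).le)
  have h : U * D * star U * A - A = U * (D * L - L) * Matrix.conjTranspose U := by
    calc U * D * star U * A - A = U * D * (star U * U) * L * star U - U * L * star U := by
          rw [← hAD]; nth_rw 1 [hAD]; noncomm_ring
      _ = U * (D * L - L) * star U := by rw [hU]; noncomm_ring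
  rw [h]
  exact hDL.mul_mul_conjTranspose_same U

end ProjNonneg

section PureState

variable {n : Type*} [Fintype n]

theorem IsPureState.posSemidef {ρ : Matrix n n ℂ} (hρ : IsPureState ρ) : ρ.PosSemidef :=
  hρ.1.posSemidef_of_mul_self hρ.2.1

variable [DecidableEq n]

theorem posSemidef_one_sub_of_mul_self {P : Matrix n n ℂ} (hP : P.IsHermitian)
    (hPP : P * P = P) : (1 - P).PosSemidef :=
  (Matrix.isHermitian_one.sub hP).posSemidef_of_mul_self (IsIdempotentElem.one_sub hPP)

theorem IsPureState.posSemidef_one_sub {ρ : Matrix n n ℂ} (hρ : IsPureState ρ) :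
    (1 - ρ).PosSemidef :=
  posSemidef_one_sub_of_mul_self hρ.1 hρ.2.1

theorem IsPureState.unitary_conj {ρ : Matrix n n ℂ} (hρ : IsPureState ρ)
    (U : Matrix.unitaryGroup n ℂ) :
    IsPureState ((U : Matrix n n ℂ) * ρ * star (U : Matrix n n ℂ)) := by
  have hU : star (U : Matrix n n ℂ) * (U : Matrix n n ℂ) = 1 := Unitary.coe_star_mul_self _
  refine ⟨Matrix.isHermitian_mul_mul_conjTranspose _ hρ.1, ?_, ?_⟩
  · calc (U : Matrix n n ℂ) * ρ * star (U : Matrix n n ℂ) *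
          ((U : Matrix n n ℂ) * ρ * star (U : Matrix n n ℂ))
        = U * ρ * (star (U : Matrix n n ℂ) * U) * ρ * star (U : Matrix n n ℂ) := by noncomm_ring
      _ = U * (ρ * ρ) * star (U : Matrix n n ℂ) := by rw [hU]; noncomm_ring
      _ = _ := by rw [hρ.2.1]
  · rw [Matrix.trace_mul_comm, ← Matrix.mul_assoc, hU, Matrix.one_mul, hρ.2.2]

/-- A pure state `W` admits a detector below a given effect `S`: `Q` is proportional to
`S R W R S`, for a projection `R` with `tr (W R) > 0`. -/
theorem IsPureState.exists_detector {W S R : Matrix n n ℂ} (hW : IsPureState W)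
    (hS : S.PosSemidef) (hS' : (1 - S).PosSemidef) (hR : R.IsHermitian) (hRR : R * R = R)
    (hp : 0 < (W * R).trace.re) :
    ∃ Q : Matrix n n ℂ, Q.PosSemidef ∧ (S - Q).PosSemidef ∧ Q.trace.re ≤ 1 ∧
      2 * (W * (S * R)).trace.re - (W * R).trace.re ≤ (W * Q).trace.re := by
  set p := (W * R).trace.re with hp_def
  have hX : (R * W * R).PosSemidef := by
    simpa [hR.eq] using hW.posSemidef.mul_mul_conjTranspose_same R
  have hXtr : (R * W * R).trace.re = p := by
    rw [Matrix.mul_assoc, Matrix.trace_mul_comm, Matrix.mul_assoc, hRR]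
  have hSS := hS.sub_mul_self hS'
  have hY : (S * (R * W * R) * S).PosSemidef := by
    simpa [hS.1.eq] using hX.mul_mul_conjTranspose_same S
  have hp' : 0 ≤ p⁻¹ := inv_nonneg.mpr hp.le
  refine ⟨p⁻¹ • (S * (R * W * R) * S), hY.smul hp', ?_, ?_, ?_⟩
  · have h1 := hX.trace_smul_one_sub
    rw [hXtr] at h1
    have h2 := ((h1.mul_mul_conjTranspose_same S).smul hp').add hSS
    convert h2 using 1
    rw [hS.1.eq, Matrix.mul_sub, Matrix.sub_mul, smul_sub, Matrix.mul_smul, Matrix.smul_mul,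
      smul_smul, inv_mul_cancel₀ hp.ne', one_smul, Matrix.mul_one]
    abel
  · have h1 : (1 - S * S).PosSemidef := by
      convert hS'.add hSS using 1
      abel
    have h2 := Matrix.PosSemidef.re_trace_mul_le h1 hX
    rw [Matrix.one_mul, hXtr] at h2
    rw [Matrix.trace_smul, Complex.smul_re, smul_eq_mul, Matrix.trace_mul_comm,
      ← Matrix.mul_assoc]
    calc p⁻¹ * (S * S * (R * W * R)).trace.re ≤ p⁻¹ * p := by gcongr
      _ = 1 := inv_mul_cancel₀ hp.ne'
  · set B := S * R with hB
    have hBH : B.conjTranspose = R * S := by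
      rw [hB, Matrix.conjTranspose_mul, hR.eq, hS.1.eq]
    have hBW : (W * B * W).trace.re = (W * B).trace.re := by
      rw [Matrix.trace_mul_comm, ← Matrix.mul_assoc, hW.2.1]
    have hBW' : (W * B.conjTranspose * W).trace.re = (W * B).trace.re := by
      rw [← hBW, ← Complex.conj_re, ← Complex.star_def, ← Matrix.trace_conjTranspose]
      simp [Matrix.conjTranspose_mul, hW.1.eq, Matrix.mul_assoc]
    have h0 := (Matrix.posSemidef_self_mul_conjTranspose (W * B * W - p • W)).re_trace_nonneg
    have hexp : (W * B * W - p • W) * (W * B * W - p • W).conjTranspose =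
        W * (B * W * B.conjTranspose) * W - p • (W * B * W) - p • (W * B.conjTranspose * W) +
          (p * p) • W := by
      have : (W * B * W - p • W).conjTranspose = W * B.conjTranspose * W - p • W := by
        simp [Matrix.conjTranspose_mul, hW.1.eq, Matrix.mul_assoc]
      rw [this, Matrix.mul_sub, Matrix.sub_mul, Matrix.sub_mul, Matrix.smul_mul, Matrix.smul_mul,
        Matrix.mul_smul, Matrix.mul_smul, hW.2.1]
      have e1 : W * B * W * (W * B.conjTranspose * W) = W * B * (W * W) * B.conjTranspose * W := by
        noncomm_ring
      have e2 : W * B * W * W = W * B * (W * W) := by noncomm_ring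
      have e3 : W * (W * B.conjTranspose * W) = (W * W) * B.conjTranspose * W := by noncomm_ring
      rw [e1, e2, e3, hW.2.1, smul_smul]
      have e4 : W * B * W * B.conjTranspose * W = W * (B * W * B.conjTranspose) * W := by
        noncomm_ring
      rw [e4]
      abel
    have hBB : (W * (B * W * B.conjTranspose) * W).trace.re =
        (W * (B * W * B.conjTranspose)).trace.re := by
      rw [Matrix.trace_mul_comm, ← Matrix.mul_assoc, hW.2.1]
    rw [hexp] at h0
    simp only [Matrix.trace_add, Matrix.trace_sub, Matrix.trace_smul, Complex.add_re,
      Complex.sub_re, Complex.smul_re, smul_eq_mul, hBW, hBW', hBB, hW.2.2, Complex.one_re] at h0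
    have hQ : S * (R * W * R) * S = B * W * B.conjTranspose := by
      rw [hBH, hB]; noncomm_ring
    rw [hQ, Matrix.mul_smul, Matrix.trace_smul, Complex.smul_re, smul_eq_mul, inv_mul_eq_div,
      le_div_iff₀ hp]
    linarith

/-- Splitting a pure state with respect to a projection `P`, tested against an effect `Q`. -/
theorem IsPureState.re_trace_mul_le_split {W P Q : Matrix n n ℂ} (hW : IsPureState W)
    (hP : P.IsHermitian) (hPP : P * P = P) (hQ : Q.PosSemidef) (hQ' : (1 - Q).PosSemidef)
    {t : ℝ} (ht : 0 < t) :
    (W * Q).trace.re ≤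
      (1 + t⁻¹) * (P * Q).trace.re + (1 + t) * (1 - (W * P).trace.re) := by
  set P' := 1 - P with hP'
  have hP'H : P'.IsHermitian := Matrix.isHermitian_one.sub hP
  have hP'P' : P' * P' = P' := IsIdempotentElem.one_sub hPP
  have hs : 0 < √t := Real.sqrt_pos.mpr ht
  have h1 : (W * Q).trace.re ≤
      (((1 + t⁻¹) • (P * W * P) + (1 + t) • (P' * W * P')) * Q).trace.re := by
    refine Matrix.PosSemidef.re_trace_mul_le ?_ hQ
    have h := hW.posSemidef.mul_mul_conjTranspose_same ((√t)⁻¹ • P - √t • P')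
    convert h using 1
    have hH : ((√t)⁻¹ • P - √t • P').conjTranspose = (√t)⁻¹ • P - √t • P' := by
      simp [hP.eq, hP'H.eq]
    have hsum : W = (P + P') * W * (P + P') := by simp [hP']
    have e1 : (√t)⁻¹ * (√t)⁻¹ = t⁻¹ := by rw [← mul_inv, Real.mul_self_sqrt ht.le]
    have e2 : √t * √t = t := Real.mul_self_sqrt ht.le
    rw [hH]
    conv_lhs => arg 2; rw [hsum]
    simp only [Matrix.mul_sub, Matrix.sub_mul, Matrix.mul_add, Matrix.add_mul, Matrix.smul_mul,
      Matrix.mul_smul, smul_smul, smul_sub, e1, e2, mul_inv_cancel₀ hs.ne',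
      inv_mul_cancel₀ hs.ne', one_smul, add_smul]
    abel
  have h2 : (P * W * P * Q).trace.re ≤ (P * Q).trace.re := by
    refine Matrix.PosSemidef.re_trace_mul_le ?_ hQ
    have h := hW.posSemidef_one_sub.mul_mul_conjTranspose_same P
    rwa [hP.eq, Matrix.mul_sub, Matrix.sub_mul, Matrix.mul_one, hPP] at h
  have h3 : (P' * W * P' * Q).trace.re ≤ 1 - (W * P).trace.re := by
    have hX : (P' * W * P').PosSemidef := by
      simpa [hP'H.eq] using hW.posSemidef.mul_mul_conjTranspose_same P'
    have h := Matrix.PosSemidef.re_trace_mul_le hQ' hX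
    rw [Matrix.trace_mul_comm, Matrix.one_mul] at h
    refine h.trans_eq ?_
    rw [Matrix.mul_assoc, Matrix.trace_mul_comm, Matrix.mul_assoc, hP'P', hP', Matrix.mul_sub,
      Matrix.mul_one, Matrix.trace_sub, hW.2.2, Complex.sub_re, Complex.one_re]
  refine h1.trans ?_
  rw [Matrix.add_mul, Matrix.smul_mul, Matrix.smul_mul, Matrix.trace_add, Matrix.trace_smul,
    Matrix.trace_smul, Complex.add_re, Complex.smul_re, Complex.smul_re, smul_eq_mul, smul_eq_mul]
  have ht' : 0 ≤ 1 + t⁻¹ := by positivity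
  gcongr

end PureState

section SpectralProjection

variable {n : Type*} [DecidableEq n] {σ : Matrix n n ℂ}

theorem Matrix.IsHermitian.sub_real_smul_one (hσ : σ.IsHermitian) (c : ℝ) :
    (σ - c • (1 : Matrix n n ℂ)).IsHermitian :=
  hσ.sub (by simp [Matrix.IsHermitian])

variable [Fintype n]

theorem mul_re_trace_projNonneg_le (hσ : σ.IsHermitian) (c : ℝ) :
    c * (projNonneg (σ - c • (1 : Matrix n n ℂ))).trace.re ≤
      (σ * projNonneg (σ - c • (1 : Matrix n n ℂ))).trace.re := by
  have h := (posSemidef_projNonneg_mul (hσ.sub_real_smul_one c)).re_trace_nonneg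
  rw [Matrix.mul_sub, Matrix.mul_smul, Matrix.mul_one, Matrix.trace_sub, Matrix.trace_smul,
    Complex.sub_re, Complex.smul_re, smul_eq_mul, Matrix.trace_mul_comm] at h
  linarith

theorem posSemidef_smul_one_sub_one_sub_projNonneg_mul (hσ : σ.IsHermitian) {c : ℝ}
    (hc : 0 ≤ c) :
    (c • (1 : Matrix n n ℂ) -
      (1 - projNonneg (σ - c • (1 : Matrix n n ℂ))) * σ).PosSemidef := by
  have h1 := posSemidef_projNonneg_mul_sub (hσ.sub_real_smul_one c)
  set P := projNonneg (σ - c • (1 : Matrix n n ℂ)) with hP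
  have hPs : P.PosSemidef :=
    (projNonneg_isHermitian _).posSemidef_of_mul_self (projNonneg_mul_self _)
  convert h1.add (hPs.smul hc) using 1
  simp only [Matrix.mul_sub, Matrix.sub_mul, Matrix.mul_smul, Matrix.mul_one, Matrix.one_mul]
  abel

/-- The defining set of `Hs ε σ` is bounded above for a state `σ` and `ε < 1`. -/
theorem IsState.bddAbove_Hs (hσ : IsState σ) {ε : ℝ} (hε : ε < 1) :
    BddAbove {lam : ℝ |
      ((σ * projNonneg (σ - Real.exp (-lam) • (1 : Matrix n n ℂ))).trace).re ≤ ε} := by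
  refine ⟨Real.log (Fintype.card n / (1 - ε)), fun lam hlam => ?_⟩
  have h := (posSemidef_smul_one_sub_one_sub_projNonneg_mul hσ.1.1
    (Real.exp_pos (-lam)).le).re_trace_nonneg
  rw [Set.mem_ofPred_eq] at hlam
  rw [Matrix.trace_sub, Matrix.sub_mul, Matrix.one_mul, Matrix.trace_sub, hσ.2,
    Matrix.trace_mul_comm, Matrix.trace_smul, Matrix.trace_one, Complex.sub_re, Complex.sub_re,
    Complex.smul_re, Complex.natCast_re, Complex.one_re, smul_eq_mul] at h
  have h' : 1 - ε ≤ Real.exp (-lam) * Fintype.card n := by linarith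
  have hexp : Real.exp lam ≤ Fintype.card n / (1 - ε) := by
    rw [le_div_iff₀ (by linarith)]
    calc Real.exp lam * (1 - ε) ≤ Real.exp lam * (Real.exp (-lam) * Fintype.card n) := by gcongr
      _ = Fintype.card n := by rw [← mul_assoc, ← Real.exp_add]; simp
  calc lam = Real.log (Real.exp lam) := (Real.log_exp lam).symm
    _ ≤ _ := Real.log_le_log (Real.exp_pos _) hexp

end SpectralProjection

/-- Effects of a sub-POVM are bounded by the identity. -/
theorem posSemidef_one_sub_of_sum {n ι : Type*} [DecidableEq n] [Fintype ι] {Q : ι → Matrix n n ℂ}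
    (hQ : ∀ i, (Q i).PosSemidef) (hQ' : (1 - ∑ i, Q i).PosSemidef) (i : ι) :
    (1 - Q i).PosSemidef := by
  classical
  have h := hQ'.add (Matrix.posSemidef_sum (Finset.univ.erase i) fun j _ => hQ j)
  convert h using 1
  rw [← Finset.add_sum_erase _ _ (Finset.mem_univ i)]
  abel

section CovariantChannel

variable {G : Type*} [Group G] [Fintype G] {n : Type*} [Fintype n] [DecidableEq n]
  (f : G →* Matrix.unitaryGroup n ℂ) (ρ : Matrix n n ℂ)

theorem trace_avf_mul_re (X : Matrix n n ℂ) :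
    (avf f ρ * X).trace.re = (Fintype.card G : ℝ)⁻¹ *
      ∑ g, ((f g : Matrix n n ℂ) * ρ * star (f g : Matrix n n ℂ) * X).trace.re := by
  have hc : ((Fintype.card G : ℂ)⁻¹) = (((Fintype.card G : ℝ)⁻¹ : ℝ) : ℂ) := by simp
  rw [avf, Matrix.smul_mul, Matrix.trace_smul, Finset.sum_mul, Matrix.trace_sum, smul_eq_mul, hc,
    Complex.re_ofReal_mul, Complex.re_sum]

theorem exists_trace_avf_mul_le (X : Matrix n n ℂ) :
    ∃ g, (avf f ρ * X).trace.re ≤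
      ((f g : Matrix n n ℂ) * ρ * star (f g : Matrix n n ℂ) * X).trace.re := by
  by_contra! h
  have h1 := Finset.sum_lt_sum_of_nonempty (Finset.univ_nonempty (α := G)) fun g _ => h g
  have hcard : (0 : ℝ) < Fintype.card G := by exact_mod_cast Fintype.card_pos
  rw [Finset.sum_const, Finset.card_univ, nsmul_eq_mul, trace_avf_mul_re,
    mul_inv_cancel_left₀ hcard.ne'] at h1
  exact h1.false

theorem commute_avf (h : G) : Commute (f h : Matrix n n ℂ) (avf f ρ) := by
  have hU : star (f h : Matrix n n ℂ) * (f h : Matrix n n ℂ) = 1 := Unitary.coe_star_mul_self _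
  have hconj : (f h : Matrix n n ℂ) * avf f ρ * star (f h : Matrix n n ℂ) = avf f ρ := by
    rw [avf, Matrix.mul_smul, Matrix.smul_mul, Finset.mul_sum, Finset.sum_mul]
    congr 1
    refine Fintype.sum_equiv (Equiv.mulLeft h) _ _ fun g => ?_
    simp [mul_assoc]
  calc (f h : Matrix n n ℂ) * avf f ρ
      = (f h : Matrix n n ℂ) * avf f ρ * (star (f h : Matrix n n ℂ) * f h) := by
        rw [hU, Matrix.mul_one]
    _ = avf f ρ * f h := by rw [← Matrix.mul_assoc, hconj]

variable {ρ}

theorem IsPureState.isState_avf (hρ : IsPureState ρ) : IsState (avf f ρ) := by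
  constructor
  · refine (Matrix.posSemidef_sum _ fun g _ => (hρ.unitary_conj (f g)).posSemidef).smul ?_
    exact inv_nonneg.mpr (Nat.cast_nonneg _)
  · have hcard : (Fintype.card G : ℂ) ≠ 0 := Nat.cast_ne_zero.mpr Fintype.card_ne_zero
    rw [avf, Matrix.trace_smul, Matrix.trace_sum,
      Finset.sum_congr rfl fun g _ => (hρ.unitary_conj (f g)).2.2]
    simp [hcard]

variable (ρ) in
/-- The channel outputs have constant overlap with an operator commuting with the
representation. -/
theorem trace_conj_mul_eq_of_commute {P : Matrix n n ℂ}
    (hP : ∀ g, Commute (f g : Matrix n n ℂ) P) (g : G) :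
    ((f g : Matrix n n ℂ) * ρ * star (f g : Matrix n n ℂ) * P).trace.re =
      (avf f ρ * P).trace.re := by
  have key : ∀ g, ((f g : Matrix n n ℂ) * ρ * star (f g : Matrix n n ℂ) * P).trace =
      (ρ * P).trace := fun g => by
    have hU : star (f g : Matrix n n ℂ) * (f g : Matrix n n ℂ) = 1 :=
      Unitary.coe_star_mul_self _
    rw [Matrix.mul_assoc, Matrix.mul_assoc, Matrix.trace_mul_comm, Matrix.mul_assoc,
      Matrix.mul_assoc, ← (hP g).eq, ← Matrix.mul_assoc (star (f g : Matrix n n ℂ)), hU,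
      Matrix.one_mul]
  have hcard : (Fintype.card G : ℝ) ≠ 0 := Nat.cast_ne_zero.mpr Fintype.card_ne_zero
  rw [trace_avf_mul_re, key g, Finset.sum_congr rfl fun g _ => congrArg Complex.re (key g),
    Finset.sum_const, Finset.card_univ, nsmul_eq_mul, inv_mul_cancel_left₀ hcard]

theorem bddAbove_codeAchievable (hρ : IsPureState ρ) {ε : ℝ} (hε : ε < 1) :
    BddAbove {M : ℕ | CodeAchievable f ρ ε M} := by
  refine ⟨⌊Fintype.card n / (1 - ε)⌋₊, ?_⟩
  rintro M ⟨enc, Q, hQ, hQ', hs⟩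
  refine Nat.le_floor ?_
  rw [le_div_iff₀ (by linarith)]
  calc (M : ℝ) * (1 - ε) = ∑ _i : Fin M, (1 - ε) := by simp [mul_sub]
    _ ≤ ∑ i, (Q i).trace.re := by
      refine Finset.sum_le_sum fun i _ => (hs i).trans ?_
      have h := Matrix.PosSemidef.re_trace_mul_le
        (hρ.unitary_conj (f (enc i))).posSemidef_one_sub (hQ i)
      rwa [Matrix.one_mul] at h
    _ ≤ Fintype.card n := by
      have h := hQ'.re_trace_nonneg
      rw [Matrix.trace_sub, Matrix.trace_one, Matrix.trace_sum, Complex.sub_re, Complex.re_sum,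
        Complex.natCast_re] at h
      linarith

theorem codeAchievable_one (hρ : IsPureState ρ) {ε : ℝ} (hε : 0 ≤ ε) :
    CodeAchievable f ρ ε 1 := by
  refine ⟨fun _ => 1, fun _ => 1, fun _ => Matrix.PosSemidef.one, ?_, fun i => ?_⟩
  · simpa using Matrix.PosSemidef.zero
  · rw [Matrix.mul_one, (hρ.unitary_conj (f 1)).2.2, Complex.one_re]
    linarith

theorem codeAchievable_Mcode (hρ : IsPureState ρ) {ε : ℝ} (hε : ε ∈ Set.Ioo (0 : ℝ) 1) :
    CodeAchievable f ρ ε (Mcode f ρ ε) :=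
  Nat.sSup_mem (s := {M | CodeAchievable f ρ ε M}) ⟨1, codeAchievable_one f hρ hε.1.le⟩
    (bddAbove_codeAchievable f hρ hε.2)

theorem one_le_Mcode (hρ : IsPureState ρ) {ε : ℝ} (hε : ε ∈ Set.Ioo (0 : ℝ) 1) :
    1 ≤ Mcode f ρ ε :=
  le_csSup (bddAbove_codeAchievable f hρ hε.2) (codeAchievable_one f hρ hε.1.le)

/-- Greedy construction of a code: as long as the effects used so far are small on the range of
the invariant projection `R`, another codeword can be added. -/
theorem exists_code (hρ : IsPureState ρ) {R : Matrix n n ℂ} (hR : R.IsHermitian)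
    (hRR : R * R = R) (hRf : ∀ g, Commute (f g : Matrix n n ℂ) R) {c : ℝ} (hc : 0 ≤ c)
    (hRc : (c • (1 : Matrix n n ℂ) - R * avf f ρ).PosSemidef) {ε : ℝ} (hε : ε < 1) (M : ℕ)
    (hM : ∀ k < M, 1 - ε ≤ (avf f ρ * R).trace.re - 2 * (c * k)) :
    ∃ (enc : Fin M → G) (Q : Fin M → Matrix n n ℂ),
      (∀ i, (Q i).PosSemidef) ∧ ((1 : Matrix n n ℂ) - ∑ i, Q i).PosSemidef ∧
      (∀ i, 1 - ε ≤
        (((f (enc i) : Matrix n n ℂ) * ρ * star (f (enc i) : Matrix n n ℂ)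
          * Q i).trace).re) ∧ (∑ i, Q i).trace.re ≤ M := by
  induction M with
  | zero =>
    exact ⟨Fin.elim0, Fin.elim0, fun i => i.elim0, by simpa using Matrix.PosSemidef.one,
      fun i => i.elim0, by simp⟩
  | succ M ih =>
    obtain ⟨enc, Q, hQ, hQ', hs, htr⟩ := ih fun k hk => hM k (hk.trans M.lt_succ_self)
    have hMM := hM M M.lt_succ_self
    have hT : (∑ i, Q i).PosSemidef := Matrix.posSemidef_sum _ fun i _ => hQ i
    set T := ∑ i, Q i with hTdef
    set σ := avf f ρ with hσ
    obtain ⟨g, hg⟩ := exists_trace_avf_mul_le f ρ ((2 : ℝ) • ((1 - T) * R) - R)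
    set W := (f g : Matrix n n ℂ) * ρ * star (f g : Matrix n n ℂ) with hW
    have hpg : (W * R).trace.re = (σ * R).trace.re := trace_conj_mul_eq_of_commute f ρ hRf g
    have hTR : (σ * (T * R)).trace.re ≤ c * M := by
      have h := Matrix.PosSemidef.re_trace_mul_le hRc hT
      rw [Matrix.smul_mul, Matrix.one_mul, Matrix.trace_smul, Complex.smul_re, smul_eq_mul,
        Matrix.mul_assoc, Matrix.trace_mul_comm, Matrix.mul_assoc] at h
      exact h.trans (by gcongr)
    have hpos : 0 ≤ c * M := by positivity
    obtain ⟨q, hq, hq', hqtr, hqs⟩ := (hρ.unitary_conj (f g)).exists_detector (S := 1 - T) hQ'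
      (by simpa using hT) hR hRR (by rw [← hW, hpg]; linarith)
    rw [← hW] at hqs
    have hlin (Y : Matrix n n ℂ) : (Y * ((2 : ℝ) • ((1 - T) * R) - R)).trace.re =
        2 * (Y * ((1 - T) * R)).trace.re - (Y * R).trace.re := by
      rw [Matrix.mul_sub, Matrix.mul_smul, Matrix.trace_sub, Matrix.trace_smul, Complex.sub_re,
        Complex.smul_re, smul_eq_mul]
    have hσT : (σ * ((1 - T) * R)).trace.re = (σ * R).trace.re - (σ * (T * R)).trace.re := by
      rw [Matrix.sub_mul, Matrix.one_mul, Matrix.mul_sub, Matrix.trace_sub, Complex.sub_re]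
    rw [← hσ, hlin, hlin, hσT] at hg
    refine ⟨Fin.snoc enc g, Fin.snoc Q q, fun i => ?_, ?_, fun i => ?_, ?_⟩
    · refine Fin.lastCases ?_ (fun j => ?_) i
      · simpa using hq
      · simpa using hQ j
    · simp only [Fin.sum_univ_castSucc, Fin.snoc_castSucc, Fin.snoc_last]
      rwa [← sub_sub]
    · refine Fin.lastCases ?_ (fun j => ?_) i
      · simp only [Fin.snoc_last]
        rw [← hW]
        linarith
      · simpa only [Fin.snoc_castSucc] using hs j
    · simp only [Fin.sum_univ_castSucc, Fin.snoc_castSucc, Fin.snoc_last]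
      rw [← hTdef, Matrix.trace_add, Complex.add_re]
      push_cast
      linarith

/-- Direct part. -/
theorem half_exp_mul_le_Mcode (hρ : IsPureState ρ) {ε δ lam : ℝ} (hε : ε ∈ Set.Ioo (0 : ℝ) 1)
    (hδ : 0 ≤ δ)
    (hlam : ((avf f ρ * projNonneg (avf f ρ - Real.exp (-lam) • (1 : Matrix n n ℂ))).trace).re ≤
      ε - δ) :
    Real.exp lam * δ / 2 ≤ Mcode f ρ ε := by
  have hσ := hρ.isState_avf f
  set σ := avf f ρ with hσdef
  set c := Real.exp (-lam) with hc
  set P := projNonneg (σ - c • (1 : Matrix n n ℂ)) with hP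
  have hPH : P.IsHermitian := projNonneg_isHermitian _
  have hPP : P * P = P := projNonneg_mul_self _
  have hcomm : ∀ g, Commute (f g : Matrix n n ℂ) (1 - P) := fun g =>
    (Commute.one_right _).sub_right (((commute_avf f ρ g).sub_right
      ((Commute.one_right _).smul_right c)).projNonneg_right)
  have htr : (σ * (1 - P)).trace.re = 1 - (σ * P).trace.re := by
    rw [Matrix.mul_sub, Matrix.mul_one, Matrix.trace_sub, hσ.2, Complex.sub_re, Complex.one_re]
  obtain ⟨enc, Q, hQ, hQ', hs, -⟩ := exists_code f hρ (Matrix.isHermitian_one.sub hPH)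
    (IsIdempotentElem.one_sub hPP) hcomm (Real.exp_pos (-lam)).le
    (posSemidef_smul_one_sub_one_sub_projNonneg_mul hσ.1.1 (Real.exp_pos (-lam)).le) hε.2
    (⌊Real.exp lam * δ / 2⌋₊ + 1) (fun k hk => by
      have hk' : (k : ℝ) ≤ Real.exp lam * δ / 2 :=
        (Nat.le_floor_iff (by positivity)).mp (Nat.lt_succ_iff.mp hk)
      have hck : c * k ≤ δ / 2 := by
        calc c * k ≤ c * (Real.exp lam * δ / 2) := by gcongr
          _ = (c * Real.exp lam) * δ / 2 := by ring
          _ = δ / 2 := by rw [hc, ← Real.exp_add]; simp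
      rw [← hσdef, htr]
      linarith)
  have hle : ⌊Real.exp lam * δ / 2⌋₊ + 1 ≤ Mcode f ρ ε :=
    le_csSup (bddAbove_codeAchievable f hρ hε.2) ⟨enc, Q, hQ, hQ', hs⟩
  calc Real.exp lam * δ / 2 ≤ (⌊Real.exp lam * δ / 2⌋₊ + 1 : ℕ) := by
        push_cast; exact (Nat.lt_floor_add_one _).le
    _ ≤ Mcode f ρ ε := by exact_mod_cast hle

/-- Converse part: an invariant projection of small trace, compared with the size of a code,
has small overlap with the average output. -/
theorem CodeAchievable.re_trace_avf_mul_le (hρ : IsPureState ρ) {ε : ℝ} {M : ℕ}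
    (hcode : CodeAchievable f ρ ε M) (hM : 0 < M) {P : Matrix n n ℂ} (hP : P.IsHermitian)
    (hPP : P * P = P) (hPf : ∀ g, Commute (f g : Matrix n n ℂ) P) {t : ℝ} (ht : 0 < t) :
    (avf f ρ * P).trace.re ≤ ε + (1 + t⁻¹) * (P.trace.re / M) + t := by
  obtain ⟨enc, Q, hQ, hQ', hs⟩ := hcode
  set a := (avf f ρ * P).trace.re with ha
  have hPs := hP.posSemidef_of_mul_self hPP
  have ha0 : 0 ≤ a := (hρ.isState_avf f).1.re_trace_mul_nonneg hPs
  have hM' : (0 : ℝ) < M := by exact_mod_cast hM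
  have h1 : ∀ i, 1 - ε ≤ (1 + t⁻¹) * (P * Q i).trace.re + (1 + t) * (1 - a) := fun i => by
    have h := (hρ.unitary_conj (f (enc i))).re_trace_mul_le_split hP hPP (hQ i)
      (posSemidef_one_sub_of_sum hQ hQ' i) ht
    rw [trace_conj_mul_eq_of_commute f ρ hPf] at h
    exact (hs i).trans h
  have h2 : ∑ i, (P * Q i).trace.re ≤ P.trace.re := by
    have h := Matrix.PosSemidef.re_trace_mul_le hQ' hPs
    rw [Matrix.trace_mul_comm, Matrix.one_mul, Finset.mul_sum, Matrix.trace_sum,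
      Complex.re_sum] at h
    exact h
  have h3 := Finset.sum_le_sum fun i (_ : i ∈ Finset.univ) => h1 i
  rw [Finset.sum_add_distrib, ← Finset.mul_sum, Finset.sum_const, Finset.sum_const,
    Finset.card_univ, Fintype.card_fin, nsmul_eq_mul, nsmul_eq_mul] at h3
  have ht' : 0 < 1 + t⁻¹ := by positivity
  have h4 : M * (1 - ε) ≤ (1 + t⁻¹) * P.trace.re + M * ((1 + t) * (1 - a)) :=
    h3.trans (by gcongr)
  have h5 : (1 + t⁻¹) * P.trace.re = M * ((1 + t⁻¹) * (P.trace.re / M)) := by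
    field_simp
  rw [h5, ← mul_add] at h4
  have h6 := le_of_mul_le_mul_left h4 hM'
  nlinarith

end CovariantChannel

/-- single-shot bounds for a pure-state group-covariant channel:
`H_s^{ε−δ₁−δ₂}(av_f[ρ]) − log(1/(δ₁δ₂)) ≤ log M(ρ,ε)` and
`log M(ρ,ε) ≤ H_s^{ε+δ₁+2δ₂}(av_f[ρ]) + log(1/(δ₁δ₂²))`. -/
theorem statement_3 {G : Type} [Group G] [Fintype G] {d : ℕ}
    (f : G →* Matrix.unitaryGroup (Fin d) ℂ)
    (ρ : Matrix (Fin d) (Fin d) ℂ) (hρ : IsPureState ρ)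
    (ε δ₁ δ₂ : ℝ) (hε : ε ∈ Set.Ioo (0 : ℝ) 1)
    (h1 : δ₁ ∈ Set.Ioo (0 : ℝ) 1) (h2 : δ₂ ∈ Set.Ioo (0 : ℝ) 1)
    (hlt : δ₁ + δ₂ < ε) (hlt2 : ε + δ₁ + 2 * δ₂ < 1) :
    Hs (ε - δ₁ - δ₂) (avf f ρ) - Real.log (1 / (δ₁ * δ₂))
      ≤ Real.log (Mcode f ρ ε) ∧
    Real.log (Mcode f ρ ε)
      ≤ Hs (ε + δ₁ + 2 * δ₂) (avf f ρ) + Real.log (1 / (δ₁ * δ₂ ^ 2)) := by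
  have hσ := hρ.isState_avf f
  have hM1 : (1 : ℝ) ≤ Mcode f ρ ε := by exact_mod_cast one_le_Mcode f hρ hε
  have hM0 : (0 : ℝ) < Mcode f ρ ε := by linarith
  obtain ⟨h1p, h1l⟩ := h1
  obtain ⟨h2p, h2l⟩ := h2
  have hprod : 0 < δ₁ * δ₂ := mul_pos h1p h2p
  constructor
  · rw [sub_le_iff_le_add, one_div, Real.log_inv]
    refine Real.sSup_le (fun lam hlam => ?_) ?_
    · have h := half_exp_mul_le_Mcode f hρ (δ := δ₁ + δ₂) hε (by linarith)
        (by rw [← sub_sub]; exact hlam)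
      have hle : Real.exp lam * (δ₁ * δ₂) ≤ Mcode f ρ ε := by
        refine le_trans ?_ h
        have : δ₁ * δ₂ ≤ (δ₁ + δ₂) / 2 := by nlinarith
        calc Real.exp lam * (δ₁ * δ₂) ≤ Real.exp lam * ((δ₁ + δ₂) / 2) := by gcongr
          _ = _ := by ring
      have hlog := Real.log_le_log (by positivity) hle
      rw [Real.log_mul (Real.exp_ne_zero _) hprod.ne', Real.log_exp] at hlog
      linarith
    · have := Real.log_nonneg hM1
      have := Real.log_nonpos hprod.le (by nlinarith)
      linarith
  · have hprod2 : 0 < δ₁ * δ₂ ^ 2 := by positivity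
    rw [one_div, Real.log_inv, ← sub_eq_add_neg, le_sub_iff_add_le,
      ← Real.log_mul hM0.ne' hprod2.ne']
    refine le_csSup (hσ.bddAbove_Hs hlt2) ?_
    rw [Set.mem_ofPred_eq]
    set x := (Mcode f ρ ε : ℝ) * (δ₁ * δ₂ ^ 2) with hx
    have hx0 : 0 < x := mul_pos hM0 hprod2
    rw [Real.exp_neg, Real.exp_log hx0]
    have htr := mul_re_trace_projNonneg_le hσ.1.1 x⁻¹
    have hcomm : ∀ g, Commute (f g : Matrix (Fin d) (Fin d) ℂ)
        (projNonneg (avf f ρ - x⁻¹ • (1 : Matrix (Fin d) (Fin d) ℂ))) := fun g =>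
      ((commute_avf f ρ g).sub_right ((Commute.one_right _).smul_right x⁻¹)).projNonneg_right
    have hPH := projNonneg_isHermitian (avf f ρ - x⁻¹ • (1 : Matrix (Fin d) (Fin d) ℂ))
    have hPP := projNonneg_mul_self (avf f ρ - x⁻¹ • (1 : Matrix (Fin d) (Fin d) ℂ))
    set P := projNonneg (avf f ρ - x⁻¹ • (1 : Matrix (Fin d) (Fin d) ℂ))
    have hle := (codeAchievable_Mcode f hρ hε).re_trace_avf_mul_le f hρ
      (one_le_Mcode f hρ hε) hPH hPP hcomm h2p
    have hone : (avf f ρ * P).trace.re ≤ 1 := by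
      have h := Matrix.PosSemidef.re_trace_mul_le (posSemidef_one_sub_of_mul_self hPH hPP) hσ.1
      rwa [Matrix.trace_mul_comm, Matrix.one_mul, hσ.2, Complex.one_re] at h
    have hPtr : P.trace.re / Mcode f ρ ε ≤ δ₁ * δ₂ ^ 2 := by
      rw [div_le_iff₀ hM0, mul_comm, ← hx]
      have := htr.trans hone
      rwa [inv_mul_le_iff₀ hx0, mul_one] at this
    have hpos : 0 ≤ 1 + δ₂⁻¹ := by positivity
    have hbound : (1 + δ₂⁻¹) * (P.trace.re / Mcode f ρ ε) ≤ δ₁ * δ₂ ^ 2 + δ₁ * δ₂ := by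
      calc (1 + δ₂⁻¹) * (P.trace.re / Mcode f ρ ε) ≤ (1 + δ₂⁻¹) * (δ₁ * δ₂ ^ 2) := by gcongr
        _ = δ₁ * δ₂ ^ 2 + δ₁ * δ₂ := by field_simp
    have hs1 : δ₁ * δ₂ ≤ δ₁ := by nlinarith
    have hs2 : δ₁ * δ₂ ^ 2 ≤ δ₂ := by nlinarith
    linarith
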